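/- Let G be a Γ-perfect Γ-group, let τ: P → G be a projective presentation of G, and let R = ker τ. Then the Γ-homomorphism τ': [P,P]_Γ/[P,R]_Γ → G induced by τ makes [P,P]_Γ/[P,R]_Γ a universal central Γ-equivariant extension of G, whose kernel is (R ∩ [P,P]_Γ)/[P,R]_Γ. -/

import Mathlib

/-- The Γ-commutator subgroup `[G,G]_Γ` of a Γ-group `G`: the subgroup generated by all
commutators together with the elements `(σ • g) * g⁻¹`. -/
def gammaCommutator (Γ G : Type*) [Group Γ] [Group G] [MulDistribMulAction Γ G] : Subgroup G :=
  Subgroup.closure ({x | ∃ a b : G, x = a * b * a⁻¹ * b⁻¹} ∪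
    {x | ∃ (σ : Γ) (g : G), x = σ • g * g⁻¹})

instance gammaCommutator_normal (Γ G : Type*) [Group Γ] [Group G] [MulDistribMulAction Γ G] :
    (gammaCommutator Γ G).Normal := by
  constructor
  intro n hn g
  have h1 : g * n * g⁻¹ * n⁻¹ ∈ gammaCommutator Γ G :=
    Subgroup.subset_closure (Or.inl ⟨g, n, rfl⟩)
  have h2 := mul_mem h1 hn
  simpa [mul_assoc] using h2

theorem gammaCommutator_smul_mem {Γ G : Type*} [Group Γ] [Group G] [MulDistribMulAction Γ G]
    (σ : Γ) {x : G} (hx : x ∈ gammaCommutator Γ G) : σ • x ∈ gammaCommutator Γ G := by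
  induction hx using Subgroup.closure_induction with
  | mem y hy =>
    rcases hy with ⟨a, b, rfl⟩ | ⟨τ, g, rfl⟩
    · refine Subgroup.subset_closure (Or.inl ⟨σ • a, σ • b, ?_⟩)
      simp [smul_mul', smul_inv']
    · refine Subgroup.subset_closure (Or.inr ⟨σ * τ * σ⁻¹, σ • g, ?_⟩)
      rw [smul_mul', smul_inv', ← mul_smul, ← mul_smul]
      simp [mul_assoc]
  | one => simpa using one_mem (gammaCommutator Γ G)
  | mul a b _ _ iha ihb => rw [smul_mul']; exact mul_mem iha ihb
  | inv a _ iha => rw [smul_inv']; exact inv_mem iha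

instance gammaCommutatorAction (Γ G : Type*) [Group Γ] [Group G] [MulDistribMulAction Γ G] :
    MulDistribMulAction Γ (gammaCommutator Γ G) where
  smul σ x := ⟨σ • (x : G), gammaCommutator_smul_mem σ x.2⟩
  one_smul x := Subtype.ext (one_smul Γ (x : G))
  mul_smul σ τ x := Subtype.ext (mul_smul σ τ (x : G))
  smul_mul σ x y := Subtype.ext (smul_mul' σ (x : G) (y : G))
  smul_one σ := Subtype.ext (smul_one σ)

instance gammaAbelianization_commGroup (Γ G : Type*) [Group Γ] [Group G]
    [MulDistribMulAction Γ G] : CommGroup (G ⧸ gammaCommutator Γ G) where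
  mul_comm a b := by
    induction a using QuotientGroup.induction_on with
    | _ x =>
    induction b using QuotientGroup.induction_on with
    | _ y =>
    rw [← QuotientGroup.mk_mul, ← QuotientGroup.mk_mul, QuotientGroup.eq]
    exact Subgroup.subset_closure (Or.inl ⟨y⁻¹, x⁻¹, by group⟩)

universe u v

/-- `φ : B →* G` is a central Γ-equivariant extension of the Γ-group `G`. -/
def IsCentralGammaExt (Γ : Type u) [Group Γ] {B G : Type v} [Group B] [Group G]
    [MulDistribMulAction Γ B] [MulDistribMulAction Γ G] (φ : B →* G) : Prop :=
  (∀ (σ : Γ) (b : B), φ (σ • b) = σ • φ b) ∧ Function.Surjective φ ∧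
    φ.ker ≤ Subgroup.center B ∧ (∀ (σ : Γ), ∀ b ∈ φ.ker, σ • b = b) ∧
    ∃ γ : G → B, (∀ (σ : Γ) (g : G), γ (σ • g) = σ • γ g) ∧ ∀ g, φ (γ g) = g

/-- A central Γ-equivariant extension `β : U →* G` is universal if for every central
Γ-equivariant extension `α : X →* G` there is a unique Γ-homomorphism `U →* X` over `G`. -/
def IsUniversalCentralGammaExt (Γ : Type u) [Group Γ] {U G : Type v} [Group U] [Group G]
    [MulDistribMulAction Γ U] [MulDistribMulAction Γ G] (β : U →* G) : Prop :=
  IsCentralGammaExt Γ β ∧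
    ∀ (X : Type v) [Group X] [MulDistribMulAction Γ X] (α : X →* G),
      IsCentralGammaExt Γ α →
        ∃! f : U →* X, (∀ (σ : Γ) (u : U), f (σ • u) = σ • f u) ∧ α.comp f = β

/-- The action of `Γ` on the free group on a Γ-set `X`, determined on generators by
`σ • ⟨x⟩ = ⟨σ • x⟩`. -/
instance freeGroupGammaAction (Γ X : Type*) [Group Γ] [MulAction Γ X] :
    MulDistribMulAction Γ (FreeGroup X) where
  smul σ w := FreeGroup.map (σ • ·) w
  one_smul w := by
    show FreeGroup.map _ w = w
    rw [show ((fun x : X => (1 : Γ) • x)) = id from funext fun x => one_smul Γ x]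
    exact FreeGroup.map.id w
  mul_smul σ τ w := by
    show FreeGroup.map _ w = FreeGroup.map _ (FreeGroup.map _ w)
    rw [FreeGroup.map.comp]
    have h : ((fun x : X => σ • x) ∘ fun x : X => τ • x) = fun x : X => (σ * τ) • x :=
      funext fun x => (mul_smul σ τ x).symm
    rw [h]
  smul_mul σ x y := map_mul (FreeGroup.map (σ • ·)) x y
  smul_one σ := map_one (FreeGroup.map (σ • ·))

/-- For a normal Γ-invariant subgroup `H` of a Γ-group `G`, the subgroup `[G,H]_Γ`
generated by the elements `x * (σ • y) * x⁻¹ * y⁻¹` with `x ∈ G`, `y ∈ H`, `σ ∈ Γ`. -/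
def gammaRelComm (Γ : Type*) {G : Type*} [Group Γ] [Group G] [MulDistribMulAction Γ G]
    (H : Subgroup G) : Subgroup G :=
  Subgroup.closure {x | ∃ (a : G) (σ : Γ), ∃ y ∈ H, x = a * (σ • y) * a⁻¹ * y⁻¹}

theorem gammaRelComm_le (Γ : Type*) {G : Type*} [Group Γ] [Group G] [MulDistribMulAction Γ G]
    (H : Subgroup G) [hn : H.Normal] (hinv : ∀ (σ : Γ), ∀ y ∈ H, σ • y ∈ H) :
    gammaRelComm Γ H ≤ H := by
  rw [gammaRelComm, Subgroup.closure_le]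
  rintro x ⟨a, σ, y, hy, rfl⟩
  exact mul_mem (hn.conj_mem _ (hinv σ y hy) a) (inv_mem hy)

theorem gammaRelComm_normal (Γ : Type*) {G : Type*} [Group Γ] [Group G]
    [MulDistribMulAction Γ G] (H : Subgroup G) [hn : H.Normal]
    (hinv : ∀ (σ : Γ), ∀ y ∈ H, σ • y ∈ H) : (gammaRelComm Γ H).Normal := by
  constructor
  intro n hnn g
  have hnH : n ∈ H := gammaRelComm_le Γ H hinv hnn
  have h1 : g * n * g⁻¹ * n⁻¹ ∈ gammaRelComm Γ H :=
    Subgroup.subset_closure ⟨g, 1, n, hnH, by rw [one_smul]⟩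
  have h2 := mul_mem h1 hnn
  simpa [mul_assoc] using h2

theorem gammaRelComm_smul_mem {Γ G : Type*} [Group Γ] [Group G] [MulDistribMulAction Γ G]
    (H : Subgroup G) (hinv : ∀ (σ : Γ), ∀ y ∈ H, σ • y ∈ H) (σ : Γ) {x : G}
    (hx : x ∈ gammaRelComm Γ H) : σ • x ∈ gammaRelComm Γ H := by
  induction hx using Subgroup.closure_induction with
  | mem z hz =>
    obtain ⟨a, τ, y, hy, rfl⟩ := hz
    refine Subgroup.subset_closure ⟨σ • a, σ * τ * σ⁻¹, σ • y, hinv σ y hy, ?_⟩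
    rw [smul_mul', smul_mul', smul_mul', smul_inv', smul_inv', ← mul_smul, ← mul_smul]
    simp [mul_assoc]
  | one => simpa using one_mem (gammaRelComm Γ H)
  | mul a b _ _ iha ihb => rw [smul_mul']; exact mul_mem iha ihb
  | inv a _ iha => rw [smul_inv']; exact inv_mem iha

/-- The Γ-action on a quotient of a Γ-group by a Γ-invariant normal subgroup. -/
def quotientGammaAction {Γ K : Type*} [Group Γ] [Group K] [MulDistribMulAction Γ K]
    (N : Subgroup K) [N.Normal] (hinv : ∀ (σ : Γ), ∀ y ∈ N, σ • y ∈ N) :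
    MulDistribMulAction Γ (K ⧸ N) where
  smul σ := QuotientGroup.map N N (MulDistribMulAction.toMonoidEnd Γ K σ)
    (fun y hy => hinv σ y hy)
  one_smul q := by
    induction q using QuotientGroup.induction_on with
    | _ x =>
      show QuotientGroup.mk ((1 : Γ) • x) = QuotientGroup.mk x
      rw [one_smul]
  mul_smul σ τ q := by
    induction q using QuotientGroup.induction_on with
    | _ x =>
      show QuotientGroup.mk ((σ * τ) • x) = QuotientGroup.mk (σ • (τ • x))
      rw [mul_smul]
  smul_mul σ a b := by
    induction a using QuotientGroup.induction_on with
    | _ x =>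
      induction b using QuotientGroup.induction_on with
      | _ y =>
        show QuotientGroup.mk (σ • (x * y)) = QuotientGroup.mk (σ • x) * QuotientGroup.mk (σ • y)
        rw [← QuotientGroup.mk_mul, smul_mul']
  smul_one σ := by
    show QuotientGroup.mk (σ • (1 : K)) = 1
    rw [smul_one]
    rfl

/-- A surjective Γ-homomorphism maps the Γ-commutator subgroup onto the Γ-commutator subgroup. -/
theorem gammaCommutator_le_map {Γ P G : Type*} [Group Γ] [Group P] [Group G]
    [MulDistribMulAction Γ P] [MulDistribMulAction Γ G] (τ : P →* G)
    (hτs : Function.Surjective τ) (hτe : ∀ (σ : Γ) (p : P), τ (σ • p) = σ • τ p) :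
    gammaCommutator Γ G ≤ (gammaCommutator Γ P).map τ := by
  refine (Subgroup.closure_le _).2 ?_
  rintro x (⟨a, b, rfl⟩ | ⟨σ, g, rfl⟩)
  · obtain ⟨a, rfl⟩ := hτs a
    obtain ⟨b, rfl⟩ := hτs b
    exact ⟨_, Subgroup.subset_closure (Or.inl ⟨a, b, rfl⟩), by simp⟩
  · obtain ⟨g, rfl⟩ := hτs g
    exact ⟨_, Subgroup.subset_closure (Or.inr ⟨σ, g, rfl⟩), by simp [hτe]⟩

/-- Every element of a Γ-group covering a Γ-perfect Γ-group is the product of a kernel element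
and an element of the Γ-commutator subgroup. -/
theorem exists_mem_ker_inv_mul_mem_gammaCommutator {Γ P G : Type*} [Group Γ] [Group P] [Group G]
    [MulDistribMulAction Γ P] [MulDistribMulAction Γ G] (τ : P →* G)
    (hτs : Function.Surjective τ) (hτe : ∀ (σ : Γ) (p : P), τ (σ • p) = σ • τ p)
    (hG : gammaCommutator Γ G = ⊤) (p : P) :
    ∃ y ∈ τ.ker, y⁻¹ * p ∈ gammaCommutator Γ P := by
  obtain ⟨c, hc, hcp⟩ := gammaCommutator_le_map τ hτs hτe (hG ▸ Subgroup.mem_top (τ p))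
  refine ⟨p * c⁻¹, ?_, by simpa using hc⟩
  rw [MonoidHom.mem_ker, map_mul, map_inv, hcp, mul_inv_cancel]

theorem mk_smul_gammaCommutator {Γ P : Type*} [Group Γ] [Group P] [MulDistribMulAction Γ P]
    (σ : Γ) (p : P) :
    (QuotientGroup.mk (σ • p) : P ⧸ gammaCommutator Γ P) = QuotientGroup.mk p := by
  rw [← div_eq_one, ← QuotientGroup.mk_div, QuotientGroup.eq_one_iff, div_eq_mul_inv]
  exact Subgroup.subset_closure (Or.inr ⟨σ, p, rfl⟩)

theorem mk_smul_gammaRelComm {Γ P : Type*} [Group Γ] [Group P] [MulDistribMulAction Γ P]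
    {H : Subgroup P} [(gammaRelComm Γ H).Normal] (σ : Γ) {y : P} (hy : y ∈ H) :
    (QuotientGroup.mk (σ • y) : P ⧸ gammaRelComm Γ H) = QuotientGroup.mk y := by
  rw [← div_eq_one, ← QuotientGroup.mk_div, QuotientGroup.eq_one_iff]
  exact Subgroup.subset_closure ⟨1, σ, y, hy, by simp [div_eq_mul_inv]⟩

theorem mk_commute_gammaRelComm {Γ P : Type*} [Group Γ] [Group P] [MulDistribMulAction Γ P]
    {H : Subgroup P} [(gammaRelComm Γ H).Normal] {y : P} (hy : y ∈ H)
    (q : P ⧸ gammaRelComm Γ H) : Commute (QuotientGroup.mk y : P ⧸ gammaRelComm Γ H) q := by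
  induction q using QuotientGroup.induction_on with
  | _ a =>
    have h : (QuotientGroup.mk (a * y * a⁻¹ * y⁻¹) : P ⧸ gammaRelComm Γ H) = 1 :=
      (QuotientGroup.eq_one_iff _).2 (Subgroup.subset_closure ⟨a, 1, y, hy, by rw [one_smul]⟩)
    simp only [QuotientGroup.mk_mul, QuotientGroup.mk_inv] at h
    rw [mul_inv_eq_one, mul_inv_eq_iff_eq_mul] at h
    exact h.symm

/-- Central factors cancel in a commutator. -/
theorem commutator_mul_of_commute {E : Type*} [Group E] {y z : E} (hy : ∀ q, Commute y q)
    (hz : ∀ q, Commute z q) (a b : E) :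
    (y * a) * (z * b) * (y * a)⁻¹ * (z * b)⁻¹ = a * b * a⁻¹ * b⁻¹ := by
  have h1 : (y * a) * (z * b) = (a * b) * (y * z) := by
    rw [(hy a).eq, mul_assoc, (hy (z * b)).eq, (hz b).eq, mul_assoc b, ← (hy z).eq]
    simp only [mul_assoc]
  have h2 : (z * b) * (y * a) = (b * a) * (y * z) := by
    rw [(hy a).eq, (hz b).eq, mul_assoc, ← mul_assoc z, (hz a).eq, mul_assoc a, ← (hy z).eq]
    simp only [mul_assoc]
  calc _ = ((y * a) * (z * b)) * ((z * b) * (y * a))⁻¹ := by group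
    _ = _ := by rw [h1, h2]; group

/-- Two homomorphisms on `[P,P]_Γ` which vanish on `[P,R]_Γ` and lift `τ` to a central
Γ-equivariant extension of the Γ-perfect Γ-group `G` agree. -/
theorem gammaCommutator_lift_unique {Γ P G Y : Type*} [Group Γ] [Group P] [Group G] [Group Y]
    [MulDistribMulAction Γ P] [MulDistribMulAction Γ G] [MulDistribMulAction Γ Y] (τ : P →* G)
    [(gammaRelComm Γ τ.ker).Normal]
    (hτs : Function.Surjective τ) (hτe : ∀ (σ : Γ) (p : P), τ (σ • p) = σ • τ p)
    (hG : gammaCommutator Γ G = ⊤) (α : Y →* G) (hc : α.ker ≤ Subgroup.center Y)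
    (ht : ∀ (σ : Γ), ∀ b ∈ α.ker, σ • b = b) (F F' : gammaCommutator Γ P →* Y)
    (hF : ∀ (σ : Γ) x, F (σ • x) = σ • F x) (hF' : ∀ (σ : Γ) x, F' (σ • x) = σ • F' x)
    (hα : ∀ x, α (F x) = τ x) (hα' : ∀ x, α (F' x) = τ x)
    (hN : ∀ x : gammaCommutator Γ P, (x : P) ∈ gammaRelComm Γ τ.ker → F x = 1)
    (hN' : ∀ x : gammaCommutator Γ P, (x : P) ∈ gammaRelComm Γ τ.ker → F' x = 1) : F = F' := by
  have hz : ∀ x, ∃ z ∈ α.ker, F x = z * F' x := fun x =>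
    ⟨F x * (F' x)⁻¹, by simp [MonoidHom.mem_ker, hα, hα'], by simp⟩
  have hcen : ∀ z ∈ α.ker, ∀ q, Commute z q := fun z hz q =>
    (Subgroup.mem_center_iff.1 (hc hz) q).symm
  have hcongr : ∀ x x' : gammaCommutator Γ P,
      (QuotientGroup.mk (x : P) : P ⧸ gammaRelComm Γ τ.ker) = QuotientGroup.mk (x' : P) →
      F x = F' x → F x' = F' x' := by
    intro x x' h hx
    have hm := QuotientGroup.eq.1 h
    have e := hN (x⁻¹ * x') hm
    have e' := hN' (x⁻¹ * x') hm
    rw [map_mul, map_inv, inv_mul_eq_one] at e e'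
    rw [← e, ← e', hx]
  ext ⟨x, hx⟩
  induction hx using Subgroup.closure_induction with
  | mem x h =>
    rcases h with ⟨a, b, rfl⟩ | ⟨σ, g, rfl⟩
    · obtain ⟨y, hy, ha⟩ := exists_mem_ker_inv_mul_mem_gammaCommutator τ hτs hτe hG a
      obtain ⟨z, hz', hb⟩ := exists_mem_ker_inv_mul_mem_gammaCommutator τ hτs hτe hG b
      obtain ⟨a, rfl⟩ : ∃ a', a = y * a' := ⟨y⁻¹ * a, by simp⟩
      obtain ⟨b, rfl⟩ : ∃ b', b = z * b' := ⟨z⁻¹ * b, by simp⟩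
      rw [inv_mul_cancel_left] at ha hb
      refine hcongr (⟨a, ha⟩ * ⟨b, hb⟩ * ⟨a, ha⟩⁻¹ * ⟨b, hb⟩⁻¹) _ ?_ ?_
      · exact (commutator_mul_of_commute (mk_commute_gammaRelComm hy)
          (mk_commute_gammaRelComm hz') (QuotientGroup.mk a) (QuotientGroup.mk b)).symm
      · obtain ⟨u, hu, ea⟩ := hz ⟨a, ha⟩
        obtain ⟨v, hv, eb⟩ := hz ⟨b, hb⟩
        simp only [map_mul, map_inv, ea, eb]
        exact commutator_mul_of_commute (hcen u hu) (hcen v hv) _ _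
    · obtain ⟨y, hy, hg⟩ := exists_mem_ker_inv_mul_mem_gammaCommutator τ hτs hτe hG g
      obtain ⟨g, rfl⟩ : ∃ g', g = y * g' := ⟨y⁻¹ * g, by simp⟩
      rw [inv_mul_cancel_left] at hg
      refine hcongr (σ • ⟨g, hg⟩ * ⟨g, hg⟩⁻¹) _ ?_ ?_
      · change (QuotientGroup.mk (σ • g * g⁻¹) : P ⧸ gammaRelComm Γ τ.ker) =
          QuotientGroup.mk (σ • (y * g) * (y * g)⁻¹)
        have hc' := mk_commute_gammaRelComm (Γ := Γ) hy (QuotientGroup.mk (σ • g * g⁻¹))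
        rw [show σ • (y * g) * (y * g)⁻¹ = σ • y * (σ • g * g⁻¹) * y⁻¹ by
            rw [smul_mul']; group, QuotientGroup.mk_mul _ _ y⁻¹, QuotientGroup.mk_mul _ (σ • y),
          mk_smul_gammaRelComm σ hy, hc'.eq, QuotientGroup.mk_inv, mul_inv_cancel_right]
      · obtain ⟨u, hu, e⟩ := hz ⟨g, hg⟩
        simp only [map_mul, map_inv, hF, hF', e, smul_mul', ht σ u hu]
        have := (hcen u hu (σ • F' ⟨g, hg⟩ * (F' ⟨g, hg⟩)⁻¹)).eq
        rw [mul_inv_rev, mul_assoc, ← mul_assoc (σ • _), ← mul_assoc, this,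
          mul_inv_cancel_right]
  | one => exact (map_one F).trans (map_one F').symm
  | mul a b ha hb iha ihb =>
    exact (map_mul F ⟨a, ha⟩ ⟨b, hb⟩).trans
      ((congrArg₂ (· * ·) iha ihb).trans (map_mul F' ⟨a, ha⟩ ⟨b, hb⟩).symm)
  | inv a ha iha =>
    exact (map_inv F ⟨a, ha⟩).trans ((congrArg (·⁻¹) iha).trans (map_inv F' ⟨a, ha⟩).symm)

/-- A retract of a free group on a Γ-set lifts along central Γ-equivariant extensions. -/
theorem IsCentralGammaExt.exists_lift {Γ : Type u} [Group Γ] {P X : Type*} {G Y : Type v}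
    [Group P] [Group G] [Group Y] [MulDistribMulAction Γ P] [MulDistribMulAction Γ G]
    [MulDistribMulAction Γ Y] [MulAction Γ X] (i : P →* FreeGroup X) (r : FreeGroup X →* P)
    (hi : ∀ (σ : Γ) (p : P), i (σ • p) = σ • i p)
    (hr : ∀ (σ : Γ) (w : FreeGroup X), r (σ • w) = σ • r w)
    (hri : r.comp i = MonoidHom.id P) (τ : P →* G)
    (hτe : ∀ (σ : Γ) (p : P), τ (σ • p) = σ • τ p) {α : Y →* G} (hα : IsCentralGammaExt Γ α) :
    ∃ h : P →* Y, (∀ (σ : Γ) (p : P), h (σ • p) = σ • h p) ∧ α.comp h = τ := by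
  obtain ⟨-, -, -, -, γ, hγe, hγ⟩ := hα
  let l : FreeGroup X →* Y := FreeGroup.lift fun x => γ (τ (r (FreeGroup.of x)))
  have hsmul : ∀ (σ : Γ) (x : X),
      σ • (FreeGroup.of x : FreeGroup X) = FreeGroup.of (σ • x) := fun σ x => FreeGroup.map.of
  have hl : ∀ (σ : Γ) (w : FreeGroup X), l (σ • w) = σ • l w := fun σ w => by
    have : l.comp (MulDistribMulAction.toMonoidEnd Γ _ σ) =
        (MulDistribMulAction.toMonoidEnd Γ Y σ).comp l := by
      ext x
      change l (σ • FreeGroup.of x) = σ • l (FreeGroup.of x)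
      rw [hsmul, FreeGroup.lift_apply_of, FreeGroup.lift_apply_of, ← hsmul, hr, hτe, hγe]
    exact DFunLike.congr_fun this w
  have hαl : α.comp l = τ.comp r := by
    ext x
    simp [l, hγ]
  refine ⟨l.comp i, fun σ p => by simp [hi, hl], ?_⟩
  rw [← MonoidHom.comp_assoc, hαl, MonoidHom.comp_assoc, hri, MonoidHom.comp_id]

/-- A Γ-homomorphism carrying `H` to central Γ-fixed elements kills `[P,H]_Γ`. -/
theorem gammaRelComm_le_ker {Γ P Y : Type*} [Group Γ] [Group P] [Group Y]
    [MulDistribMulAction Γ P] [MulDistribMulAction Γ Y] {H : Subgroup P} (h : P →* Y)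
    (he : ∀ (σ : Γ) (p : P), h (σ • p) = σ • h p)
    (hc : ∀ y ∈ H, h y ∈ Subgroup.center Y) (ht : ∀ (σ : Γ), ∀ y ∈ H, σ • h y = h y) :
    gammaRelComm Γ H ≤ h.ker := by
  refine (Subgroup.closure_le _).2 ?_
  rintro x ⟨a, σ, y, hy, rfl⟩
  have := Subgroup.mem_center_iff.1 (hc y hy) (h a)
  simp [MonoidHom.mem_ker, he, ht σ y hy, this]

/-- Let `G` be a Γ-perfect Γ-group and `τ : P →* G` a projective
presentation of `G` (so `P` is a retract of a free group on a Γ-set, and `τ` is a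
surjective Γ-homomorphism with a Γ-equivariant set-theoretic section); let `R = ker τ`.
Then the homomorphism `τ' : [P,P]_Γ/[P,R]_Γ →* G` induced by `τ` is a universal central
Γ-equivariant extension of `G`, and its kernel is `(R ⊓ [P,P]_Γ)/[P,R]_Γ`. -/
theorem projectivePresentation_universalCentralGammaExt {Γ : Type u} [Group Γ]
    {P G : Type v} [Group P] [Group G] [MulDistribMulAction Γ P] [MulDistribMulAction Γ G]
    (X : Type v) [MulAction Γ X] (i : P →* FreeGroup X) (r : FreeGroup X →* P)
    (hi : ∀ (σ : Γ) (p : P), i (σ • p) = σ • i p)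
    (hr : ∀ (σ : Γ) (w : FreeGroup X), r (σ • w) = σ • r w)
    (hri : r.comp i = MonoidHom.id P)
    (τ : P →* G) (hτs : Function.Surjective τ)
    (hτe : ∀ (σ : Γ) (p : P), τ (σ • p) = σ • τ p)
    (hsec : ∃ s : G → P, (∀ (σ : Γ) (g : G), s (σ • g) = σ • s g) ∧ ∀ g, τ (s g) = g)
    (hGperf : gammaCommutator Γ G = ⊤) :
    have hkerinv : ∀ (σ : Γ), ∀ y ∈ τ.ker, σ • y ∈ τ.ker := fun σ y hy => by
      rw [MonoidHom.mem_ker] at hy ⊢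
      rw [hτe, hy, smul_one]
    haveI hN : (gammaRelComm Γ τ.ker).Normal := gammaRelComm_normal Γ τ.ker hkerinv
    letI instQ : MulDistribMulAction Γ ((gammaCommutator Γ P) ⧸
        ((gammaRelComm Γ τ.ker).subgroupOf (gammaCommutator Γ P))) :=
      quotientGammaAction _ (fun σ y hy => Subgroup.mem_subgroupOf.2
        (gammaRelComm_smul_mem τ.ker hkerinv σ (Subgroup.mem_subgroupOf.1 hy)))
    let τ' : ((gammaCommutator Γ P) ⧸
        ((gammaRelComm Γ τ.ker).subgroupOf (gammaCommutator Γ P))) →* G :=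
      QuotientGroup.lift _ (τ.comp (gammaCommutator Γ P).subtype) (fun y hy =>
        MonoidHom.mem_ker.mpr (show τ ((gammaCommutator Γ P).subtype y) = 1 from
          MonoidHom.mem_ker.mp
            (gammaRelComm_le Γ τ.ker hkerinv (Subgroup.mem_subgroupOf.mp hy))))
    IsUniversalCentralGammaExt Γ τ' ∧
      τ'.ker = Subgroup.map
        (QuotientGroup.mk' ((gammaRelComm Γ τ.ker).subgroupOf (gammaCommutator Γ P)))
        ((τ.ker ⊓ gammaCommutator Γ P).subgroupOf (gammaCommutator Γ P)) := by
  intro hkerinv τ'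
  have hN : (gammaRelComm Γ τ.ker).Normal := gammaRelComm_normal Γ τ.ker hkerinv
  let instQ : MulDistribMulAction Γ ((gammaCommutator Γ P) ⧸
      ((gammaRelComm Γ τ.ker).subgroupOf (gammaCommutator Γ P))) :=
    quotientGammaAction _ (fun σ y hy => Subgroup.mem_subgroupOf.2
      (gammaRelComm_smul_mem τ.ker hkerinv σ (Subgroup.mem_subgroupOf.1 hy)))
  have hmk : ∀ x y : gammaCommutator Γ P,
      (QuotientGroup.mk (x : P) : P ⧸ gammaRelComm Γ τ.ker) = QuotientGroup.mk (y : P) →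
      (QuotientGroup.mk x : (gammaCommutator Γ P) ⧸
        ((gammaRelComm Γ τ.ker).subgroupOf (gammaCommutator Γ P))) = QuotientGroup.mk y :=
    fun x y h => QuotientGroup.eq.2 (Subgroup.mem_subgroupOf.2 (QuotientGroup.eq.1 h))
  have hτ' : ∀ x : gammaCommutator Γ P, τ' (QuotientGroup.mk x) = τ x := fun _ => rfl
  have hmem : ∀ x : gammaCommutator Γ P, QuotientGroup.mk x ∈ τ'.ker → (x : P) ∈ τ.ker :=
    fun _ h => h
  refine ⟨⟨⟨?_, ?_, ?_, ?_, ?_⟩, ?_⟩, ?_⟩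
  · intro σ b
    induction b using QuotientGroup.induction_on with
    | _ x => exact hτe σ x
  · intro g
    obtain ⟨c, hc, rfl⟩ := gammaCommutator_le_map τ hτs hτe (hGperf ▸ Subgroup.mem_top g)
    exact ⟨QuotientGroup.mk ⟨c, hc⟩, rfl⟩
  · intro b hb
    induction b using QuotientGroup.induction_on with
    | _ x =>
      refine Subgroup.mem_center_iff.2 fun q => ?_
      induction q using QuotientGroup.induction_on with
      | _ y =>
        exact hmk (y * x) (x * y)
          (mk_commute_gammaRelComm (hmem x hb) (QuotientGroup.mk (y : P))).eq.symm
  · intro σ b hb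
    induction b using QuotientGroup.induction_on with
    | _ x => exact hmk (σ • x) x (mk_smul_gammaRelComm σ (hmem x hb))
  · obtain ⟨s, hse, hs⟩ := hsec
    have hk : ∀ q : P ⧸ gammaCommutator Γ P, ∃ y ∈ τ.ker, QuotientGroup.mk y = q := by
      intro q
      induction q using QuotientGroup.induction_on with
      | _ p =>
        obtain ⟨y, hy, h⟩ :=
          exists_mem_ker_inv_mul_mem_gammaCommutator τ hτs hτe hGperf p
        exact ⟨y, hy, QuotientGroup.eq.2 h⟩
    choose k hkker hk using hk
    refine ⟨fun g => QuotientGroup.mk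
      ⟨(k (QuotientGroup.mk (s g)))⁻¹ * s g, QuotientGroup.eq.1 (hk _)⟩, ?_, ?_⟩
    · intro σ g
      refine hmk _ (σ • _) ?_
      change QuotientGroup.mk ((k (QuotientGroup.mk (s (σ • g))))⁻¹ * s (σ • g)) =
        QuotientGroup.mk (σ • ((k (QuotientGroup.mk (s g)))⁻¹ * s g))
      rw [hse, mk_smul_gammaCommutator, smul_mul', QuotientGroup.mk_mul, QuotientGroup.mk_mul,
        mk_smul_gammaRelComm σ (inv_mem (hkker _))]
    · intro g
      rw [hτ', map_mul, map_inv, MonoidHom.mem_ker.1 (hkker _), hs, inv_one, one_mul]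
  · intro Y _ _ α hα
    obtain ⟨h, he, hh⟩ := hα.exists_lift i r hi hr hri τ hτe
    have hhα : ∀ y ∈ τ.ker, h y ∈ α.ker := fun y hy => by
      rw [MonoidHom.mem_ker, ← MonoidHom.comp_apply, hh]
      exact hy
    have hker : gammaRelComm Γ τ.ker ≤ h.ker := gammaRelComm_le_ker h he
      (fun y hy => hα.2.2.1 (hhα y hy)) (fun σ y hy => hα.2.2.2.1 σ _ (hhα y hy))
    refine ⟨QuotientGroup.lift _ (h.comp (gammaCommutator Γ P).subtype)
      (fun y hy => hker (Subgroup.mem_subgroupOf.1 hy)), ⟨?_, ?_⟩, ?_⟩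
    · intro σ u
      induction u using QuotientGroup.induction_on with
      | _ x => exact he σ x
    · ext x
      exact DFunLike.congr_fun hh (x : P)
    · rintro f ⟨hfe, hf⟩
      refine QuotientGroup.monoidHom_ext _ ?_
      refine gammaCommutator_lift_unique τ hτs hτe hGperf α hα.2.2.1 hα.2.2.2.1 _ _
        (fun σ x => hfe σ (QuotientGroup.mk x)) (fun σ x => he σ x)
        (fun x => DFunLike.congr_fun hf (QuotientGroup.mk x))
        (fun x => DFunLike.congr_fun hh (x : P)) (fun x hx => ?_) (fun x hx => hker hx)
      have : (QuotientGroup.mk x : (gammaCommutator Γ P) ⧸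
          ((gammaRelComm Γ τ.ker).subgroupOf (gammaCommutator Γ P))) = 1 :=
        (QuotientGroup.eq_one_iff _).2 (Subgroup.mem_subgroupOf.2 hx)
      exact (congrArg f this).trans (map_one f)
  · ext b
    induction b using QuotientGroup.induction_on with
    | _ x =>
      constructor
      · exact fun hb => ⟨x, ⟨hb, x.2⟩, rfl⟩
      · rintro ⟨y, hy, e⟩
        exact e ▸ (hy.1 : y.1 ∈ τ.ker)
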